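/- Let p be an odd prime, G = C × H where C = ⟨c⟩ ≅ C₄, c₁ = c², C₁ = ⟨c₁⟩, and H ≅ C_p × C_p. Let K ∈ Sup₂^min(G_r) and 𝒜 = V(K,G). Suppose that C is not an 𝒜-subgroup, X is the basic set of 𝒜 containing c, U = ⟨X⟩, and |U| = 4p. Then for every basic set Y of 𝒜 outside U, one of the following holds: (1) C₁ ≤ rad(Y); (2) there exists an 𝒜-subgroup A of order p with A ≰ U; (3) H is an 𝒜-subgroup. -/

import Mathlib

open scoped Pointwise

noncomputable section

namespace Paper

/-- The element `∑_{x ∈ X} x` of the integer group ring `ℤG`. -/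
def sumElems {G : Type*} [Group G] [Finite G] (X : Set G) : MonoidAlgebra ℤ G :=
  ∑ x ∈ X.toFinite.toFinset, MonoidAlgebra.single x (1 : ℤ)

/-- A Schur ring (S-ring) over a finite group `G`, described by the partition of `G`
into its basic sets: the partition contains `{1}`, is closed under taking inverses,
and its `ℤ`-span inside the group ring `ℤG` is closed under multiplication
(hence is a subring of `ℤG`). -/
structure SRing (G : Type*) [Group G] [Finite G] where
  basic : Set (Set G)
  nonempty : ∀ X ∈ basic, X.Nonempty
  cover : ∀ g : G, ∃! X, X ∈ basic ∧ g ∈ X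
  one_mem : ({1} : Set G) ∈ basic
  inv_mem : ∀ X ∈ basic, X⁻¹ ∈ basic
  mul_mem : ∀ a b : MonoidAlgebra ℤ G,
    a ∈ Submodule.span ℤ (sumElems '' basic) →
    b ∈ Submodule.span ℤ (sumElems '' basic) →
    a * b ∈ Submodule.span ℤ (sumElems '' basic)

namespace SRing

/-- The `ℤ`-module underlying an S-ring. -/
def span {G : Type*} [Group G] [Finite G] (A : SRing G) :
    Submodule ℤ (MonoidAlgebra ℤ G) :=
  Submodule.span ℤ (sumElems '' A.basic)

/-- A set `X ⊆ G` is an `𝒜`-set if `∑_{x ∈ X} x ∈ 𝒜`. -/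
def IsASet {G : Type*} [Group G] [Finite G] (A : SRing G) (X : Set G) : Prop :=
  sumElems X ∈ A.span

/-- A subgroup which is an `𝒜`-set is an `𝒜`-subgroup. -/
def IsASubgroup {G : Type*} [Group G] [Finite G] (A : SRing G) (H : Subgroup G) : Prop :=
  A.IsASet (H : Set G)

end SRing

/-- The arc set `R(X) = {(g, xg) : x ∈ X, g ∈ G}` of the Cayley digraph `Cay(G, X)`. -/
def Rel {G : Type*} [Group G] (X : Set G) : Set (G × G) := {p | p.2 * p.1⁻¹ ∈ X}

/-- `f : G ≃ G'` is an isomorphism from the S-ring `A` over `G` to the S-ring `B`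
over `G'` if `{R(X)^f : X ∈ 𝒮(A)} = {R(Y) : Y ∈ 𝒮(B)}`. -/
def IsSRingIso {G G' : Type*} [Group G] [Finite G] [Group G'] [Finite G']
    (A : SRing G) (B : SRing G') (f : G ≃ G') : Prop :=
  (fun X => Prod.map f f '' Rel X) '' A.basic = Rel '' B.basic

/-- The automorphism group `Aut(𝒜)` of an S-ring, as a set of permutations of `G`. -/
def SRing.autSet {G : Type*} [Group G] [Finite G] (A : SRing G) : Set (Equiv.Perm G) :=
  {f | ∀ X ∈ A.basic, Prod.map f f '' Rel X = Rel X}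

/-- The set `Iso(𝒜)` of isomorphisms from `𝒜` onto S-rings over the same group `G`. -/
def SRing.isoSet {G : Type*} [Group G] [Finite G] (A : SRing G) : Set (Equiv.Perm G) :=
  {f | ∃ B : SRing G, IsSRingIso A B f}

/-- `Aut(G)` as a set of permutations of `G`. -/
def autPerm (G : Type*) [Group G] : Set (Equiv.Perm G) :=
  Set.range fun φ : G ≃* G => (φ.toEquiv : Equiv.Perm G)

/-- A CI-S-ring: `Aut(𝒜)·Aut(G) = Iso(𝒜)`. -/
def SRing.IsCI {G : Type*} [Group G] [Finite G] (A : SRing G) : Prop :=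
  A.autSet * autPerm G = A.isoSet

/-- The orbits on `G` of a set of automorphisms of `G`. -/
def setOrbits {G : Type*} [Group G] (Δ : Set (MulAut G)) : Set (Set G) :=
  Set.range fun g : G => (fun φ : MulAut G => φ g) '' Δ

/-- An S-ring is cyclotomic if its basic sets are exactly the orbits of some
subgroup `K ≤ Aut(G)`. -/
def SRing.IsCyclotomic {G : Type*} [Group G] [Finite G] (A : SRing G) : Prop :=
  ∃ K : Subgroup (MulAut G), A.basic = setOrbits (K : Set (MulAut G))

/-- `Aut_G(𝒜) = Aut(𝒜) ∩ Aut(G)`, as a set of automorphisms of `G`. -/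
def SRing.autGSet {G : Type*} [Group G] [Finite G] (A : SRing G) : Set (MulAut G) :=
  {φ | (φ.toEquiv : Equiv.Perm G) ∈ A.autSet}

/-- A (cyclotomic) S-ring is Cayley minimal if `Aut_G(𝒜)` is the only subgroup of
`Aut(G)` whose orbits on `G` coincide with those of `Aut_G(𝒜)`. -/
def SRing.IsCayleyMinimal {G : Type*} [Group G] [Finite G] (A : SRing G) : Prop :=
  ∀ K : Subgroup (MulAut G),
    setOrbits (K : Set (MulAut G)) = setOrbits A.autGSet →
    (K : Set (MulAut G)) = A.autGSet

/-- `rad(X) = {g ∈ G : gX = Xg = X}`. -/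
def rad {G : Type*} [Group G] (X : Set G) : Set G := {g | {g} * X = X ∧ X * {g} = X}

/-- The class `𝓔_c` of finite abelian groups all of whose Sylow subgroups are
elementary abelian or isomorphic to `C₄`. -/
def InEc (G : Type*) [CommGroup G] [Finite G] : Prop :=
  ∀ p : ℕ, p.Prime → ∀ P : Sylow p G,
    (∀ x : ↥(P : Subgroup G), x ^ p = 1) ∨
    Nonempty (↥(P : Subgroup G) ≃* Multiplicative (ZMod 4))

/-- A finite group `G` is a `DCI`-group if any two Cayley digraphs over `G` that are
isomorphic as digraphs are Cayley isomorphic. -/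
def IsDCIGroup (G : Type*) [Group G] : Prop :=
  ∀ S T : Set G,
    (∃ f : G ≃ G, ∀ g h : G, h * g⁻¹ ∈ S ↔ f h * (f g)⁻¹ ∈ T) →
    ∃ φ : G ≃* G, ⇑φ '' S = T

/-- The subgroup `G_r ≤ Sym(G)` of right translations of `G`. -/
def rightTranslations (G : Type*) [Group G] : Subgroup (Equiv.Perm G) where
  carrier := Set.range fun g : G => Equiv.mulRight g
  one_mem' := ⟨1, by ext x; simp⟩
  mul_mem' := by
    rintro _ _ ⟨a, rfl⟩ ⟨b, rfl⟩
    exact ⟨b * a, by ext x; simp [mul_assoc]⟩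
  inv_mem' := by
    rintro _ ⟨a, rfl⟩
    exact ⟨a⁻¹, by ext x; simp⟩

/-- The basic sets of the S-ring `V(K, G)`: the orbits of the stabilizer `K_e`
of the identity on `G`. -/
def VBasic {G : Type*} [Group G] (K : Subgroup (Equiv.Perm G)) : Set (Set G) :=
  Set.range fun g : G => MulAction.orbit (MulAction.stabilizer K (1 : G)) g

/-- A subgroup `R ≤ Sym(G)` is regular if for all `g, h ∈ G` there is a
unique `r ∈ R` with `r(g) = h`. -/
def IsRegularSubgroup {G : Type*} [Group G] (R : Subgroup (Equiv.Perm G)) : Prop :=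
  ∀ g h : G, ∃! r : R, (r : Equiv.Perm G) g = h

/-- `K ∈ Sup(G_r)`. -/
def InSup {G : Type*} [Group G] (K : Subgroup (Equiv.Perm G)) : Prop :=
  rightTranslations G ≤ K

/-- `K ∈ Sup₂(G_r)`, i.e. `K ≥ G_r` and `K = K^{(2)} = Aut(V(K,G))`. -/
def InSup2 {G : Type*} [Group G] [Finite G] (K : Subgroup (Equiv.Perm G)) : Prop :=
  InSup K ∧
    (K : Set (Equiv.Perm G)) =
      {f : Equiv.Perm G | ∀ X ∈ VBasic K, Prod.map (⇑f) (⇑f) '' Rel X = Rel X}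

/-- `K₁ ⪯_G K₂`: `K₁ ≤ K₂` and every regular subgroup of `K₂` isomorphic to `G`
is conjugate in `K₂` to a subgroup of `K₁`. -/
def GComplete {G : Type*} [Group G] (K₁ K₂ : Subgroup (Equiv.Perm G)) : Prop :=
  K₁ ≤ K₂ ∧ ∀ R : Subgroup (Equiv.Perm G), R ≤ K₂ → IsRegularSubgroup R →
    Nonempty (↥R ≃* G) → ∃ k ∈ K₂, ∀ r ∈ R, k * r * k⁻¹ ∈ K₁

/-- `K ∈ Sup₂^min(G_r)`: a minimal element of `Sup₂(G_r)` with respect to `⪯_G`. -/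
def InSup2Min {G : Type*} [Group G] [Finite G] (K : Subgroup (Equiv.Perm G)) : Prop :=
  InSup2 K ∧ ∀ K' : Subgroup (Equiv.Perm G), InSup2 K' → GComplete K' K → K' = K

/-- The basic sets of the restriction `𝒜_U` of `𝒜` to an `𝒜`-subgroup `U`:
the basic sets of `𝒜` contained in `U`, viewed inside `U`. -/
def restrictBasic {G : Type*} [Group G] [Finite G] (A : SRing G) (U : Subgroup G) :
    Set (Set ↥U) :=
  {Y : Set ↥U | Subtype.val '' Y ∈ A.basic}

/-- The basic sets of the quotient S-ring `𝒜_{G/L}`: the images of the basic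
sets of `𝒜` under the canonical epimorphism `G → G/L`. -/
def quotBasic {G : Type*} [CommGroup G] [Finite G] (A : SRing G) (L : Subgroup G) :
    Set (Set (G ⧸ L)) :=
  (fun X => QuotientGroup.mk '' X) '' A.basic

/-- The basic sets of the S-ring `𝒜_S` on the section `S = U/L`: the images under
the canonical epimorphism `U → U/L` of the basic sets of `𝒜` contained in `U`. -/
def secBasic {G : Type*} [CommGroup G] [Finite G] (A : SRing G) (U L : Subgroup G) :
    Set (Set (↥U ⧸ L.subgroupOf U)) :=
  {Z | ∃ X ∈ A.basic, X ⊆ (U : Set G) ∧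
    Z = QuotientGroup.mk '' (Subtype.val ⁻¹' X : Set ↥U)}

/-- The set of bijections of `H ⧸ N` induced by members of `Δ ⊆ Sym(H)`
permuting the `N`-cosets. -/
def inducedOnQuot {H : Type*} [CommGroup H] (N : Subgroup H) (Δ : Set (Equiv.Perm H)) :
    Set (Equiv.Perm (H ⧸ N)) :=
  {σ | ∃ f ∈ Δ, ∀ x : H, σ (QuotientGroup.mk x) = QuotientGroup.mk (f x)}

/-- The canonical (injective) homomorphism `U/L → G/L` for `L ≤ U ≤ G`. -/
def secIncl {G : Type*} [CommGroup G] (U L : Subgroup G) :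
    (↥U ⧸ L.subgroupOf U) →* G ⧸ L :=
  QuotientGroup.map (L.subgroupOf U) L U.subtype (fun _ hx => hx)

/-- The set of bijections of the section `S = U/L` induced by members of
`Δ ⊆ Sym(G/L)` preserving `S` (i.e. permuting the `L`-cosets contained in `U`). -/
def inducedOnSec {G : Type*} [CommGroup G] (U L : Subgroup G)
    (Δ : Set (Equiv.Perm (G ⧸ L))) : Set (Equiv.Perm (↥U ⧸ L.subgroupOf U)) :=
  {σ | ∃ φ ∈ Δ, ∀ x : ↥U,
    φ (QuotientGroup.mk (x : G) : G ⧸ L) = secIncl U L (σ (QuotientGroup.mk x))}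

/-- The basic sets of the S-ring `(ℤL ⊗ 𝒜_V) ≀_{(V×L)/V} ℤ(U/V)` over `U`,
where `Lu, V ≤ U` and `𝒜_V` is the restriction of `𝒜_U` to `V`. -/
def tensorWreathBasic {U : Type*} [CommGroup U] [Finite U] (AU : SRing U)
    (Lu V : Subgroup U) : Set (Set U) :=
  {Z | (∃ l ∈ Lu, ∃ X ∈ AU.basic, X ⊆ (V : Set U) ∧ Z = l • X) ∨
       (∃ u : U, u ∉ Lu ⊔ V ∧ Z = u • (V : Set U))}

/-- Condition (CA): `𝒜_S = ℤS`. -/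
def CondCA {G : Type*} [CommGroup G] [Finite G] (A : SRing G) (U L : Subgroup G) : Prop :=
  ∀ AS : SRing (↥U ⧸ L.subgroupOf U), AS.basic = secBasic A U L →
    AS.basic = Set.range fun s => ({s} : Set (↥U ⧸ L.subgroupOf U))

/-- Condition (CA'): `𝒜_U` or `𝒜_{G/L}` is cyclotomic and `𝒜_S` is Cayley minimal. -/
def CondCA' {G : Type*} [CommGroup G] [Finite G] (A : SRing G) (U L : Subgroup G) : Prop :=
  ((∀ AU : SRing ↥U, AU.basic = restrictBasic A U → AU.IsCyclotomic) ∨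
   (∀ AQ : SRing (G ⧸ L), AQ.basic = quotBasic A L → AQ.IsCyclotomic)) ∧
  (∀ AS : SRing (↥U ⧸ L.subgroupOf U), AS.basic = secBasic A U L → AS.IsCayleyMinimal)

/-- Condition (CA''): `U ≅ C_{4p}`, `L ≅ C₂` and
`𝒜_U = (ℤL ⊗ 𝒜_V) ≀_{(V×L)/V} ℤ(U/V)` for an `𝒜_U`-subgroup `V` of order `p`. -/
def CondCA'' {G : Type*} [CommGroup G] [Finite G] (p : ℕ) (A : SRing G)
    (U L : Subgroup G) : Prop :=
  Nat.card ↥U = 4 * p ∧ IsCyclic ↥U ∧ Nat.card ↥L = 2 ∧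
  ∀ AU : SRing ↥U, AU.basic = restrictBasic A U →
    ∃ V : Subgroup ↥U, AU.IsASubgroup V ∧ Nat.card ↥V = p ∧
      AU.basic = tensorWreathBasic AU (L.subgroupOf U) V

/-- `𝒜 = 𝒜_{G₁} ⊗ 𝒜_{G₂}` for `G = G₁ × G₂` (internally). -/
def IsTensorDecomp {G : Type*} [CommGroup G] [Finite G] (A : SRing G)
    (G₁ G₂ : Subgroup G) : Prop :=
  A.IsASubgroup G₁ ∧ A.IsASubgroup G₂ ∧ G₁ ⊓ G₂ = ⊥ ∧ G₁ ⊔ G₂ = ⊤ ∧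
  A.basic = {Z | ∃ X ∈ A.basic, ∃ Y ∈ A.basic,
    X ⊆ (G₁ : Set G) ∧ Y ⊆ (G₂ : Set G) ∧ Z = X * Y}

/-- `𝒜` is the tensor product of two S-rings over proper nontrivial subgroups of `G`. -/
def TensorConclusion {G : Type*} [CommGroup G] [Finite G] (A : SRing G) : Prop :=
  ∃ G₁ G₂ : Subgroup G, G₁ ≠ ⊥ ∧ G₁ ≠ ⊤ ∧ G₂ ≠ ⊥ ∧ G₂ ≠ ⊤ ∧ IsTensorDecomp A G₁ G₂

/-- `𝒜` is a nontrivial `S = U/L`-wreath product satisfying one of the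
conditions (CA), (CA'), (CA''). -/
def WreathConclusion {G : Type*} [CommGroup G] [Finite G] (p : ℕ) (A : SRing G) : Prop :=
  ∃ U L : Subgroup G, L ≤ U ∧ A.IsASubgroup U ∧ A.IsASubgroup L ∧ L ≠ ⊥ ∧ U ≠ ⊤ ∧
    (∀ X ∈ A.basic, ¬ X ⊆ (U : Set G) → (L : Set G) ⊆ rad X) ∧
    (CondCA A U L ∨ CondCA' A U L ∨ CondCA'' p A U L)


section SRingBasics

variable {G : Type*} [Group G] [Finite G]

open scoped Classical in
lemma coeff_sumElems (S : Set G) (g : G) :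
    (sumElems S).coeff g = if g ∈ S then 1 else 0 := by
  simp [sumElems, MonoidAlgebra.coeff_sum, Finsupp.finsetSum_apply, Finsupp.single_apply]

namespace SRing

lemma mem_span_iff (A : SRing G) (a : MonoidAlgebra ℤ G) :
    a ∈ A.span ↔ ∀ B ∈ A.basic, ∀ x ∈ B, ∀ y ∈ B, a.coeff x = a.coeff y := by
  classical
  constructor
  · intro ha B hB x hx y hy
    induction ha using Submodule.span_induction with
    | mem b hb =>
      obtain ⟨B', hB', rfl⟩ := hb
      have key : x ∈ B' ↔ y ∈ B' := by
        constructor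
        · intro h
          rwa [(A.cover x).unique ⟨hB', h⟩ ⟨hB, hx⟩]
        · intro h
          rwa [(A.cover y).unique ⟨hB', h⟩ ⟨hB, hy⟩]
      simp only [coeff_sumElems, key]
    | zero => simp
    | add b c _ _ hb hc => simp [hb, hc]
    | smul n b _ hb => rw [MonoidAlgebra.coeff_smul_apply, MonoidAlgebra.coeff_smul_apply, hb]
  · intro h
    have := Fintype.ofFinite G
    have hfin : A.basic.Finite := Set.toFinite _
    have hne : ∀ B : Set G, ∃ g : G, B ∈ A.basic → g ∈ B := by
      intro B
      by_cases hB : B ∈ A.basic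
      · obtain ⟨g, hg⟩ := A.nonempty B hB
        exact ⟨g, fun _ => hg⟩
      · exact ⟨1, fun h => absurd h hB⟩
    choose r hr using hne
    have ha : a = ∑ B ∈ hfin.toFinset, a.coeff (r B) • sumElems B := by
      apply MonoidAlgebra.ext
      ext g
      obtain ⟨B, ⟨hB, hgB⟩, hu⟩ := A.cover g
      rw [MonoidAlgebra.coeff_sum, Finsupp.finsetSum_apply, Finset.sum_eq_single B]
      · rw [MonoidAlgebra.coeff_smul_apply, coeff_sumElems, if_pos hgB, smul_eq_mul, mul_one]
        exact h B hB g hgB (r B) (hr B hB)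
      · intro B' hB' hne
        have : g ∉ B' := fun hg => hne (hu B' ⟨by simpa using hB', hg⟩)
        rw [MonoidAlgebra.coeff_smul_apply, coeff_sumElems, if_neg this, smul_zero]
      · intro h'
        simp [hB] at h'
    rw [ha]
    refine Submodule.sum_mem _ fun B hB => Submodule.smul_mem _ _ (Submodule.subset_span ?_)
    exact ⟨B, by simpa using hB, rfl⟩

lemma isASet_iff (A : SRing G) (S : Set G) :
    A.IsASet S ↔ ∀ B ∈ A.basic, ∀ x ∈ B, ∀ y ∈ B, x ∈ S → y ∈ S := by
  classical
  rw [IsASet, mem_span_iff]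
  simp only [coeff_sumElems]
  constructor
  · intro h B hB x hx y hy hxS
    by_contra hyS
    simpa [hxS, hyS] using h B hB x hx y hy
  · intro h B hB x hx y hy
    have : x ∈ S ↔ y ∈ S := ⟨h B hB x hx y hy, h B hB y hy x hx⟩
    simp only [this]

lemma isASet_of_mem_basic (A : SRing G) {B : Set G} (hB : B ∈ A.basic) : A.IsASet B :=
  Submodule.subset_span ⟨B, hB, rfl⟩

lemma IsASet.subset {A : SRing G} {S B : Set G} (hS : A.IsASet S) (hB : B ∈ A.basic)
    {x : G} (hx : x ∈ B) (hxS : x ∈ S) : B ⊆ S :=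
  fun y hy => (A.isASet_iff S).1 hS B hB x hx y hy hxS

lemma IsASet.inter {A : SRing G} {S T : Set G} (hS : A.IsASet S) (hT : A.IsASet T) :
    A.IsASet (S ∩ T) :=
  (A.isASet_iff _).2 fun _ hB _ hx _ hy h =>
    ⟨hS.subset hB hx h.1 hy, hT.subset hB hx h.2 hy⟩

lemma IsASet.diff {A : SRing G} {S T : Set G} (hS : A.IsASet S) (hT : A.IsASet T) :
    A.IsASet (S \ T) :=
  (A.isASet_iff _).2 fun _ hB _ hx _ hy h =>
    ⟨hS.subset hB hx h.1 hy, fun h' => h.2 (hT.subset hB hy h' hx)⟩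

lemma IsASet.mul {A : SRing G} {S T : Set G} (hS : A.IsASet S) (hT : A.IsASet T) :
    A.IsASet (S * T) := by
  classical
  have := Fintype.ofFinite G
  have hmem : sumElems S * sumElems T ∈ A.span := A.mul_mem _ _ hS hT
  rw [mem_span_iff] at hmem
  have key : ∀ g : G, g ∈ S * T ↔ (sumElems S * sumElems T).coeff g ≠ 0 := by
    intro g
    rw [MonoidAlgebra.coeff_mul_antidiag _ _ g
      (Finset.univ.filter fun q : G × G => q.1 * q.2 = g) (by simp)]
    rw [Ne, Finset.sum_eq_zero_iff_of_nonneg]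
    · simp only [coeff_sumElems, Finset.mem_filter, Finset.mem_univ, true_and, Set.mem_mul]
      constructor
      · rintro ⟨s, hs, t, ht, rfl⟩
        intro h
        simpa [hs, ht] using h (s, t) rfl
      · intro h
        push Not at h
        obtain ⟨⟨s, t⟩, rfl, h⟩ := h
        refine ⟨s, ?_, t, ?_, rfl⟩ <;> by_contra h' <;> simp [h'] at h
    · intro q _
      simp only [coeff_sumElems]
      positivity
  refine (A.isASet_iff _).2 fun B hB x hx y hy h => ?_
  rw [key] at h ⊢
  rwa [← hmem B hB x hx y hy]

lemma isASubgroup_closure (A : SRing G) {S : Set G} (hS : A.IsASet S) :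
    A.IsASubgroup (Subgroup.closure S) := by
  refine (A.isASet_iff _).2 fun B hB x hx y hy h => ?_
  induction h using Subgroup.closure_induction generalizing B y with
  | mem x hxS => exact Subgroup.subset_closure (hS.subset hB hx hxS hy)
  | one =>
    have := (A.cover 1).unique ⟨hB, hx⟩ ⟨A.one_mem, rfl⟩
    subst this
    rw [Set.mem_singleton_iff.1 hy]
    exact Subgroup.one_mem _
  | mul s t _ _ hs ht =>
    obtain ⟨S', ⟨hS', hsS⟩, _⟩ := A.cover s
    obtain ⟨T', ⟨hT', htT⟩, _⟩ := A.cover t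
    obtain ⟨s', hs', t', ht', rfl⟩ :=
      ((A.isASet_of_mem_basic hS').mul (A.isASet_of_mem_basic hT')).subset hB hx
        (Set.mul_mem_mul hsS htT) hy
    exact Subgroup.mul_mem _ (hs S' hS' hsS s' hs') (ht T' hT' htT t' ht')
  | inv s _ hs =>
    have := hs B⁻¹ (A.inv_mem B hB) (by simpa using hx) y⁻¹ (by simpa using hy)
    simpa using this

end SRing

end SRingBasics

section PowerSets

variable {G : Type*} [CommGroup G] [Finite G]

namespace SRing

/-- Schur's theorem on `q`-th powers: for a prime `q`, the set of elements having a number of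
`q`-th roots in the `𝒜`-set `S` which is not divisible by `q` is an `𝒜`-set. -/
lemma IsASet.powSet {A : SRing G} {S : Set G} (hS : A.IsASet S) {q : ℕ} (hq : q.Prime) :
    A.IsASet {g | ¬ q ∣ {y ∈ S | y ^ q = g}.ncard} := by
  classical
  have := Fact.mk hq
  have : CharP (MonoidAlgebra (ZMod q) G) q :=
    charP_of_injective_algebraMap
      (FaithfulSMul.algebraMap_injective (ZMod q) (MonoidAlgebra (ZMod q) G)) q
  have : ExpChar (MonoidAlgebra (ZMod q) G) q := ExpChar.prime hq
  have hpow : ∀ n : ℕ, sumElems S ^ (n + 1) ∈ A.span := by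
    intro n
    induction n with
    | zero => rwa [zero_add, pow_one]
    | succ n ih => rw [pow_succ]; exact A.mul_mem _ _ ih hS
  have hmem : sumElems S ^ q ∈ A.span := by
    obtain ⟨n, rfl⟩ := Nat.exists_eq_succ_of_ne_zero hq.ne_zero
    exact hpow n
  have key : ∀ g : G, (((sumElems S ^ q).coeff g : ℤ) : ZMod q) =
      ({y ∈ S | y ^ q = g}.ncard : ZMod q) := by
    intro g
    have h1 : (((sumElems S ^ q).coeff g : ℤ) : ZMod q) =
        (MonoidAlgebra.mapRingHom G (Int.castRingHom (ZMod q)) (sumElems S ^ q)).coeff g := by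
      rw [MonoidAlgebra.coeff_mapRingHom, eq_intCast]
    rw [h1, map_pow, sumElems, map_sum, sum_pow_char]
    simp only [MonoidAlgebra.mapRingHom_single, MonoidAlgebra.single_pow, map_one, one_pow,
      MonoidAlgebra.coeff_sum, Finsupp.finsetSum_apply, MonoidAlgebra.coeff_single, Finsupp.single_apply]
    rw [Finset.sum_boole]
    congr 1
    rw [← Set.ncard_coe_finset]
    congr 1
    ext y
    simp
  rw [mem_span_iff] at hmem
  refine (A.isASet_iff _).2 fun B hB x hx y hy h => ?_
  simp only [Set.mem_ofPred_eq, ← ZMod.natCast_eq_zero_iff, ← key] at h ⊢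
  rwa [← hmem B hB x hx y hy]

end SRing

end PowerSets

section Minimality

variable {G : Type*} [CommGroup G]

lemma mem_rel_map_iff (f : Equiv.Perm G) (X : Set G) :
    Prod.map (⇑f) (⇑f) '' Rel X = Rel X ↔ ∀ g h, h * g⁻¹ ∈ X ↔ f h * (f g)⁻¹ ∈ X := by
  constructor
  · intro hX g h
    have h1 : (g, h) ∈ Rel X ↔ Prod.map f f (g, h) ∈ Prod.map (⇑f) (⇑f) '' Rel X :=
      ((f.injective.prodMap f.injective).mem_set_image).symm
    rw [hX] at h1
    exact h1
  · intro hX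
    ext ⟨a, b⟩
    constructor
    · rintro ⟨⟨g, h⟩, hgh, hab⟩
      rw [← hab]
      exact (hX g h).1 hgh
    · intro hab
      refine ⟨(f.symm a, f.symm b), (hX _ _).2 ?_, by simp⟩
      simpa [Rel] using hab

lemma mem_VBasic_orbit_iff {K : Subgroup (Equiv.Perm G)} {x y : G} :
    y ∈ MulAction.orbit (MulAction.stabilizer K (1 : G)) x ↔ ∃ k ∈ K, k 1 = 1 ∧ k x = y := by
  constructor
  · rintro ⟨⟨⟨k, hk⟩, hk1⟩, rfl⟩
    exact ⟨k, hk, hk1, rfl⟩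
  · rintro ⟨k, hk, hk1, rfl⟩
    exact ⟨⟨⟨k, hk⟩, hk1⟩, rfl⟩

lemma forall_VBasic_rel_iff {K : Subgroup (Equiv.Perm G)} (f : Equiv.Perm G) :
    (∀ X ∈ VBasic K, Prod.map (⇑f) (⇑f) '' Rel X = Rel X) ↔
      ∀ g h, ∃ k ∈ K, k 1 = 1 ∧ k (h * g⁻¹) = f h * (f g)⁻¹ := by
  simp only [mem_rel_map_iff]
  constructor
  · intro hf g h
    exact mem_VBasic_orbit_iff.1
      ((hf _ ⟨h * g⁻¹, rfl⟩ g h).1 (MulAction.mem_orbit_self _))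
  · rintro hf _ ⟨x, rfl⟩ g h
    have := mem_VBasic_orbit_iff.2 (hf g h)
    rw [← MulAction.orbit_eq_iff] at this
    simp only [← MulAction.orbit_eq_iff, this]

lemma InSup.exists_fix {K : Subgroup (Equiv.Perm G)} (hK : InSup K) {f : Equiv.Perm G}
    (hf : f ∈ K) (g h : G) : ∃ k ∈ K, k 1 = 1 ∧ k (h * g⁻¹) = f h * (f g)⁻¹ := by
  refine ⟨Equiv.mulRight (f g)⁻¹ * f * Equiv.mulRight g,
    K.mul_mem (K.mul_mem (hK ⟨_, rfl⟩) hf) (hK ⟨_, rfl⟩), by simp, by simp⟩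

lemma inSup2_iff [Finite G] {K : Subgroup (Equiv.Perm G)} :
    InSup2 K ↔ InSup K ∧ ∀ f : Equiv.Perm G,
      (∀ g h, ∃ k ∈ K, k 1 = 1 ∧ k (h * g⁻¹) = f h * (f g)⁻¹) → f ∈ K := by
  refine and_congr_right fun hK => ?_
  rw [Set.ext_iff]
  simp only [SetLike.mem_coe, Set.mem_ofPred_eq, forall_VBasic_rel_iff]
  exact ⟨fun h f => (h f).2, fun h f => ⟨fun hf => hK.exists_fix hf, h f⟩⟩

/-- The group of permutations of `G` inducing a translation on `G ⧸ U`. -/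
def quotTranslations (U : Subgroup G) : Subgroup (Equiv.Perm G) where
  carrier := {f | ∃ g : G ⧸ U, ∀ x : G, (f x : G ⧸ U) = g * x}
  one_mem' := ⟨1, fun x => by simp⟩
  mul_mem' := by
    rintro f f' ⟨g, hg⟩ ⟨g', hg'⟩
    exact ⟨g * g', fun x => by rw [Equiv.Perm.mul_apply, hg, hg', mul_assoc]⟩
  inv_mem' := by
    rintro f ⟨g, hg⟩
    refine ⟨g⁻¹, fun x => ?_⟩
    rw [eq_inv_mul_iff_mul_eq, ← hg]
    simp

/-- The action on the set of `U`-cosets of a permutation group having `U` as a block. -/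
def quotHom {U : Subgroup G} {K : Subgroup (Equiv.Perm G)}
    (h : ∀ k ∈ K, ∀ x y : G, (x : G ⧸ U) = y → (k x : G ⧸ U) = k y) :
    K →* Equiv.Perm (G ⧸ U) where
  toFun k :=
    { toFun := Quotient.map' k.1 fun x y hxy =>
        Quotient.exact' (h k.1 k.2 x y (Quotient.sound' hxy))
      invFun := Quotient.map' (k⁻¹).1 fun x y hxy =>
        Quotient.exact' (h (k⁻¹).1 (k⁻¹).2 x y (Quotient.sound' hxy))
      left_inv := by
        intro q
        induction q using Quotient.inductionOn'
        simp
      right_inv := by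
        intro q
        induction q using Quotient.inductionOn'
        simp }
  map_one' := by
    ext q
    induction q using Quotient.inductionOn'
    rfl
  map_mul' k l := by
    ext q
    induction q using Quotient.inductionOn'
    rfl

lemma card_of_transitive_of_comm {Q : Type*} [Finite Q] [Nonempty Q]
    {R : Subgroup (Equiv.Perm Q)} (hcomm : ∀ r ∈ R, ∀ s ∈ R, r * s = s * r)
    (htrans : ∀ a b : Q, ∃ r ∈ R, r a = b) : Nat.card R = Nat.card Q := by
  obtain ⟨a⟩ := ‹Nonempty Q›
  refine Nat.card_eq_of_bijective (fun r : R => r.1 a) ⟨?_, ?_⟩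
  · rintro ⟨r, hr⟩ ⟨s, hs⟩ hrs
    simp only [Subtype.mk.injEq]
    ext b
    obtain ⟨t, ht, rfl⟩ := htrans a b
    have h1 := congrArg (fun f : Equiv.Perm Q => f a) (hcomm r hr t ht)
    have h2 := congrArg (fun f : Equiv.Perm Q => f a) (hcomm s hs t ht)
    simp only [Equiv.Perm.mul_apply] at h1 h2 hrs
    rw [h1, h2, hrs]
  · intro b
    obtain ⟨r, hr, h⟩ := htrans a b
    exact ⟨⟨r, hr⟩, h⟩

/-- Two subgroups of prime order `p` of a permutation group of degree `p` are conjugate. -/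
lemma exists_conj_of_card_eq_prime {Q : Type*} [Finite Q] {p : ℕ} (hp : p.Prime)
    (hQ : Nat.card Q = p) {M R T : Subgroup (Equiv.Perm Q)} (hRM : R ≤ M) (hTM : T ≤ M)
    (hR : Nat.card R = p) (hT : Nat.card T = p) :
    ∃ m ∈ M, ∀ r ∈ R, m * r * m⁻¹ ∈ T := by
  have := Fact.mk hp
  have hfact : (Nat.card M).factorization p = 1 := by
    have h1 : Nat.card M ∣ p.factorial := by
      rw [← hQ, ← Nat.card_perm]
      exact Subgroup.card_subgroup_dvd_card M
    have h2 : p ∣ Nat.card M := hT ▸ Subgroup.card_dvd_of_le hTM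
    have h3 : p.factorial.factorization p = 1 := by
      rw [Nat.factorization_factorial hp (b := 2) (Nat.log_lt_of_lt_pow hp.ne_zero
        (by nlinarith [hp.one_lt]))]
      simp [Nat.div_self hp.pos]
    have h4 := (Nat.factorization_le_iff_dvd Nat.card_pos.ne' (Nat.factorial_ne_zero p)).2 h1 p
    have h5 := hp.factorization_pos_of_dvd Nat.card_pos.ne' h2
    omega
  have hcard : ∀ S : Subgroup (Equiv.Perm Q), S ≤ M → Nat.card S = p →
      Nat.card (S.subgroupOf M) = p ^ (Nat.card M).factorization p := by
    intro S hS hSp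
    rw [Nat.card_congr (Subgroup.subgroupOfEquivOfLe hS).toEquiv, hSp, hfact, pow_one]
  obtain ⟨m, hm⟩ := MulAction.exists_smul_eq M (Sylow.ofCard _ (hcard R hRM hR))
    (Sylow.ofCard _ (hcard T hTM hT))
  refine ⟨m, m.2, fun r hr => ?_⟩
  have hm' : m * ⟨r, hRM hr⟩ * m⁻¹ ∈ (Sylow.ofCard _ (hcard T hTM hT) : Subgroup M) := by
    rw [← hm]
    exact ⟨⟨r, hRM hr⟩, hr, rfl⟩
  exact hm'

/-- If `K ∈ Sup₂^min(G_r)` and `U` is a `K_e`-invariant subgroup of prime index, then `K_e`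
leaves every `U`-coset invariant. -/
lemma InSup2Min.mk_eq_of_fix [Finite G] {K : Subgroup (Equiv.Perm G)} (hK : InSup2Min K)
    {U : Subgroup G} {p : ℕ} (hp : p.Prime) (hidx : Nat.card (G ⧸ U) = p)
    (hU : ∀ k ∈ K, k 1 = 1 → ∀ x ∈ U, k x ∈ U) {k : Equiv.Perm G} (hk : k ∈ K)
    (hk1 : k 1 = 1) (x : G) : (k x : G ⧸ U) = x := by
  have hsup := (inSup2_iff.1 hK.1).1
  have hblock : ∀ k ∈ K, ∀ x y : G, (x : G ⧸ U) = y → (k x : G ⧸ U) = k y := by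
    intro k hk x y hxy
    obtain ⟨l, hl, hl1, hlx⟩ := hsup.exists_fix hk x y
    have := hU l hl hl1 (y * x⁻¹) (by rw [mul_comm]; exact QuotientGroup.eq.1 hxy)
    rw [hlx, mul_comm] at this
    exact QuotientGroup.eq.2 this
  suffices h : K ⊓ quotTranslations U = K by
    rw [← h] at hk
    obtain ⟨g, hg⟩ := hk.2
    have h1 := hg 1
    rw [hk1, QuotientGroup.mk_one, mul_one] at h1
    rw [hg x, ← h1, one_mul]
  have htr : ∀ g : G, Equiv.mulRight g ∈ quotTranslations U := fun g =>
    ⟨g, fun x => by rw [Equiv.coe_mulRight, QuotientGroup.mk_mul, mul_comm]⟩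
  apply hK.2
  · refine inSup2_iff.2 ⟨?_, fun f hf => ⟨?_, ?_⟩⟩
    · rintro _ ⟨g, rfl⟩
      exact ⟨hsup ⟨g, rfl⟩, htr g⟩
    · refine (inSup2_iff.1 hK.1).2 f fun g h => ?_
      obtain ⟨l, hl, h'⟩ := hf g h
      exact ⟨l, hl.1, h'⟩
    · refine ⟨f 1, fun x => ?_⟩
      obtain ⟨l, ⟨-, a, ha⟩, hl1, hlx⟩ := hf 1 x
      have h1 := ha 1
      rw [hl1, QuotientGroup.mk_one, mul_one] at h1
      have h2 := ha (x * 1⁻¹)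
      rw [hlx, ← h1, one_mul, inv_one, mul_one, QuotientGroup.mk_mul, QuotientGroup.mk_inv,
        mul_inv_eq_iff_eq_mul, mul_comm] at h2
      exact h2
  · refine ⟨inf_le_left, fun R hRK hR ⟨e⟩ => ?_⟩
    let φ := quotHom hblock
    have hφ : ∀ (k : K) (x : G), φ k x = (k.1 x : G ⧸ U) := fun _ _ => rfl
    let T := ((K ⊓ quotTranslations U).subgroupOf K).map φ
    let R' := (R.subgroupOf K).map φ
    have hTfun : ∀ t ∈ T, ∃ g : G ⧸ U, ∀ q, t q = g * q := by
      rintro _ ⟨k, ⟨-, g, hg⟩, rfl⟩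
      refine ⟨g, fun q => ?_⟩
      induction q using QuotientGroup.induction_on with
      | H x => exact hg x
    have hTcard : Nat.card T = p := by
      rw [← hidx]
      apply card_of_transitive_of_comm
      · intro r hr s hs
        obtain ⟨a, ha⟩ := hTfun r hr
        obtain ⟨b, hb⟩ := hTfun s hs
        ext q
        simp only [Equiv.Perm.mul_apply, ha, hb]
        rw [mul_left_comm]
      · intro a b
        induction a using QuotientGroup.induction_on with
        | H x =>
        induction b using QuotientGroup.induction_on with
        | H y =>
        refine ⟨_, ⟨⟨Equiv.mulRight (x⁻¹ * y), hsup ⟨_, rfl⟩⟩, ⟨hsup ⟨_, rfl⟩, htr _⟩, rfl⟩, ?_⟩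
        rw [hφ]
        simp
    have hRcard : Nat.card R' = p := by
      rw [← hidx]
      apply card_of_transitive_of_comm
      · rintro _ ⟨r, hr, rfl⟩ _ ⟨s, hs, rfl⟩
        rw [← map_mul, ← map_mul]
        congr 1
        have h1 : (⟨r, hr⟩ : R) * ⟨s, hs⟩ = ⟨s, hs⟩ * ⟨r, hr⟩ :=
          e.injective (by rw [map_mul, map_mul, mul_comm])
        exact Subtype.ext (congrArg (Subtype.val : R → Equiv.Perm G) h1)
      · intro a b
        induction a using QuotientGroup.induction_on with
        | H x =>
        induction b using QuotientGroup.induction_on with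
        | H y =>
        obtain ⟨r, hr, -⟩ := hR x y
        exact ⟨_, ⟨⟨r, hRK r.2⟩, r.2, rfl⟩, by rw [hφ, hr]⟩
    obtain ⟨_, ⟨k, rfl⟩, hk⟩ := exists_conj_of_card_eq_prime hp hidx
      (Subgroup.map_le_range φ _) (Subgroup.map_le_range φ _) hRcard hTcard
    refine ⟨k, k.2, fun r hr => ⟨K.mul_mem (K.mul_mem k.2 (hRK hr)) (K.inv_mem k.2), ?_⟩⟩
    obtain ⟨g, hg⟩ := hTfun _ (hk (φ ⟨r, hRK hr⟩) ⟨⟨r, hRK hr⟩, hr, rfl⟩)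
    exact ⟨g, fun x => hg x⟩

end Minimality

/-- Suppose `C = ⟨c⟩` is not an `𝒜`-subgroup, `X` is the basic
set of `𝒜` containing `c`, `U = ⟨X⟩` and `|U| = 4p`. Then for every basic set `Y`
of `𝒜` outside `U`: `C₁ ≤ rad(Y)`, or there is an `𝒜`-subgroup `A'` of order `p`
with `A' ≰ U`, or `H` is an `𝒜`-subgroup. -/
theorem stmt17 (p : ℕ) (hp : p.Prime) (hodd : Odd p)
    (G : Type*) [CommGroup G] [Finite G] (C H : Subgroup G)
    (hC : Nonempty (↥C ≃* Multiplicative (ZMod 4)))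
    (hH : Nonempty (↥H ≃* Multiplicative (ZMod p) × Multiplicative (ZMod p)))
    (hinf : C ⊓ H = ⊥) (hsup : C ⊔ H = ⊤)
    (K : Subgroup (Equiv.Perm G)) (hK : InSup2Min K)
    (A : SRing G) (hA : A.basic = VBasic K)
    (c : G) (hc : Subgroup.zpowers c = C) (hc4 : orderOf c = 4)
    (hCA : ¬ A.IsASubgroup C)
    (X : Set G) (hX : X ∈ A.basic) (hcX : c ∈ X)
    (hU : Nat.card ↥(Subgroup.closure X) = 4 * p) :
    ∀ Y ∈ A.basic, ¬ Y ⊆ (Subgroup.closure X : Set G) →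
      ((Subgroup.zpowers (c ^ 2) : Set G) ⊆ rad Y ∨
       (∃ A' : Subgroup G, A.IsASubgroup A' ∧ Nat.card ↥A' = p ∧
          ¬ A' ≤ Subgroup.closure X) ∨
       A.IsASubgroup H) := by
  intro Y hY hYU
  have := Fact.mk hp
  set U := Subgroup.closure X
  set e := c ^ 2 with he
  obtain ⟨m, hm⟩ := hodd
  have hCcard : Nat.card C = 4 := by rw [← hc, Nat.card_zpowers, hc4]
  have hHcard : Nat.card H = p ^ 2 := by
    obtain ⟨f⟩ := hH
    rw [Nat.card_congr f.toEquiv, Nat.card_prod, Nat.card_congr Multiplicative.toAdd,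
      Nat.card_zmod, sq]
  have hGcard : Nat.card G = 4 * p ^ 2 := by
    rw [← hCcard, ← hHcard]
    refine (Subgroup.isComplement'_of_disjoint_and_mul_eq_univ
      (disjoint_iff.2 hinf) ?_).card_mul_card.symm
    rw [← Subgroup.mul_normal, hsup, Subgroup.coe_top]
  have hidx : Nat.card (G ⧸ U) = p := by
    have h := Subgroup.card_eq_card_quotient_mul_card_subgroup U
    rw [hGcard, hU] at h
    have hpos := hp.pos
    apply Nat.eq_of_mul_eq_mul_right (show 0 < 4 * p by omega)
    rw [← h]
    ring
  have hHp : ∀ h ∈ H, h ^ p = 1 := by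
    obtain ⟨f⟩ := hH
    intro h hh
    have : (⟨h, hh⟩ : H) ^ p = 1 := by
      apply f.injective
      rw [map_pow, map_one]
      ext <;> simp
    simpa using congrArg Subtype.val this
  have hcC : c ∈ C := hc ▸ Subgroup.mem_zpowers c
  have hcU : c ∈ U := Subgroup.subset_closure hcX
  have hCU : C ≤ U := by rwa [← hc, Subgroup.zpowers_le]
  have heC : e ∈ C := pow_mem hcC 2
  have he1 : e ≠ 1 := by
    intro h
    have := orderOf_dvd_of_pow_eq_one h
    rw [hc4] at this
    omega
  have hc4' : c ^ 4 = 1 := hc4 ▸ pow_orderOf_eq_one c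
  have hee : e * e = 1 := by
    rw [he, ← pow_add]
    exact hc4'
  have hCcases : ∀ k ∈ C, k = 1 ∨ k = c ∨ k = e ∨ k = e * c := by
    classical
    intro k hk
    rw [← hc, mem_zpowers_iff_mem_range_orderOf, hc4] at hk
    simp only [Finset.mem_image, Finset.mem_range] at hk
    obtain ⟨i, hi, rfl⟩ := hk
    interval_cases i
    · simp
    · simp
    · simp [he]
    · simp [he, pow_succ]
  have hC1 : ∀ k ∈ C, k ^ 2 = 1 → k = 1 ∨ k = e := by
    intro k hk hk2
    rcases hCcases k hk with h | h | h | h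
    · exact Or.inl h
    · rw [h] at hk2
      exact absurd hk2 he1
    · exact Or.inr h
    · rw [h, mul_pow, sq e, hee, one_mul] at hk2
      exact absurd hk2 he1
  have hC2 : ∀ k ∈ C, k ^ 2 ≠ 1 → k ^ 2 = e ∧ c ∈ Subgroup.zpowers k := by
    intro k hk hk2
    rcases hCcases k hk with h | h | h | h
    · simp [h] at hk2
    · exact ⟨h ▸ rfl, h ▸ Subgroup.mem_zpowers c⟩
    · rw [h, sq, hee] at hk2
      exact absurd rfl hk2
    · refine ⟨by rw [h, mul_pow, sq e, hee, one_mul], ⟨3, ?_⟩⟩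
      have h3 : k ^ 3 = c := by
        rw [h, he, ← pow_succ, ← pow_mul, show (2 + 1) * 3 = 4 * 2 + 1 by norm_num, pow_add,
          pow_mul, hc4', one_pow, one_mul, pow_one]
      change k ^ (3 : ℤ) = c
      exact_mod_cast h3
  have hgp : ∀ g : G, g ^ p ∈ C := by
    intro g
    obtain ⟨k, hk, h, hh, rfl⟩ := Subgroup.mem_sup.1 (hsup ▸ Subgroup.mem_top g : g ∈ C ⊔ H)
    rw [mul_pow, hHp h hh, mul_one]
    exact pow_mem hk p
  have hid : ∀ g : G, g = g ^ p * ((g ^ 2) ^ m)⁻¹ := by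
    intro g
    rw [hm, pow_succ, pow_mul, mul_inv_cancel_comm]
  have hsqC : ∀ g : G, g ^ 2 ∈ C → g ∈ C := by
    intro g hg
    rw [hid g]
    exact C.mul_mem (hgp g) (C.inv_mem (pow_mem hg m))
  have hsqU : ∀ g : G, g ^ 2 ∈ U → g ∈ U := by
    intro g hg
    rw [hid g]
    exact U.mul_mem (hCU (hgp g)) (U.inv_mem (pow_mem hg m))
  have hinv : ∀ g : G, g ^ 2 = 1 → g = 1 ∨ g = e :=
    fun g hg => hC1 g (hsqC g (hg ▸ C.one_mem)) hg
  have hmemH : ∀ g : G, g ^ p = 1 → g ∈ H := by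
    intro g hg
    obtain ⟨k, hk, h, hh, rfl⟩ := Subgroup.mem_sup.1 (hsup ▸ Subgroup.mem_top g : g ∈ C ⊔ H)
    have hk1 : k ∈ C ⊓ H := by
      refine ⟨hk, ?_⟩
      rw [mul_pow, hHp h hh, mul_one] at hg
      have hco : Nat.Coprime p (orderOf k) := by
        have h4 : orderOf k ∣ 2 ^ 2 := by
          have := Subgroup.orderOf_dvd_natCard C hk
          rwa [hCcard] at this
        refine Nat.Coprime.coprime_dvd_right h4 (Nat.Coprime.pow_right 2 ?_)
        rw [Nat.coprime_two_right]
        exact ⟨m, hm⟩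
      have h1 : orderOf k = 1 :=
        Nat.eq_one_of_dvd_coprimes hco (orderOf_dvd_of_pow_eq_one hg) dvd_rfl
      rw [orderOf_eq_one_iff.1 h1]
      exact H.one_mem
    rw [hinf, Subgroup.mem_bot] at hk1
    rwa [hk1, one_mul]
  have heH : e ∉ H := by
    intro h
    have : e ∈ C ⊓ H := ⟨heC, h⟩
    rw [hinf] at this
    exact he1 this
  have hCgen : ∀ S : Set G, A.IsASet S → S ⊆ C → ∀ k ∈ S, k ^ 2 = 1 := by
    intro S hS hSC k hk
    by_contra hk2
    apply hCA
    have h : Subgroup.closure S = C := by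
      apply le_antisymm ((Subgroup.closure_le C).2 hSC)
      rw [← hc, Subgroup.zpowers_le]
      exact (Subgroup.zpowers_le.2 (Subgroup.subset_closure hk)) (hC2 k (hSC hk) hk2).2
    exact h ▸ A.isASubgroup_closure hS
  have hUA : A.IsASubgroup U := A.isASubgroup_closure (A.isASet_of_mem_basic hX)
  -- basic sets are orbits, and lie in `U`-cosets
  have horb : ∀ B ∈ A.basic, ∀ x ∈ B, ∀ y, y ∈ B ↔ ∃ k ∈ K, k 1 = 1 ∧ k x = y := by
    intro B hB x hx y
    rw [hA] at hB
    obtain ⟨z, rfl⟩ := hB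
    rw [← mem_VBasic_orbit_iff]
    rw [← MulAction.orbit_eq_iff] at hx
    exact hx ▸ Iff.rfl
  have hcos : ∀ B ∈ A.basic, ∀ x ∈ B, ∀ y ∈ B, (x : G ⧸ U) = y := by
    intro B hB x hx y hy
    obtain ⟨k, hk, hk1, rfl⟩ := (horb B hB x hx y).1 hy
    refine (hK.mk_eq_of_fix hp hidx ?_ hk hk1 x).symm
    intro k hk hk1 z hz
    obtain ⟨B', ⟨hB', hzB'⟩, -⟩ := A.cover z
    exact hUA.subset hB' hzB' hz ((horb B' hB' z hzB' _).2 ⟨k, hk, hk1, rfl⟩)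
  have hcosA : ∀ q : G ⧸ U, A.IsASet {g | (g : G ⧸ U) = q} := by
    intro q
    refine (A.isASet_iff _).2 fun B hB x hx y hy h => ?_
    rw [Set.mem_ofPred_eq] at h ⊢
    rw [← h, hcos B hB x hx y hy]
  have hYout : ∀ y ∈ Y, y ∉ U := fun y hy h => hYU (hUA.subset hY hy h)
  -- an `𝒜`-set inside `H` and not inside `U` suffices
  have hF : ∀ S : Set G, A.IsASet S → S ⊆ H → (∃ s ∈ S, s ∉ U) →
      (∃ A' : Subgroup G, A.IsASubgroup A' ∧ Nat.card A' = p ∧ ¬ A' ≤ U) ∨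
        A.IsASubgroup H := by
    rintro S hS hSH ⟨s, hsS, hsU⟩
    have hle : Subgroup.closure S ≤ H := (Subgroup.closure_le H).2 hSH
    have hsA : s ∈ Subgroup.closure S := Subgroup.subset_closure hsS
    have hdvd := Subgroup.card_dvd_of_le hle
    rw [hHcard] at hdvd
    obtain ⟨i, hi, hcard⟩ := (Nat.dvd_prime_pow hp).1 hdvd
    interval_cases i
    · rw [pow_zero, Subgroup.card_eq_one] at hcard
      rw [hcard, Subgroup.mem_bot] at hsA
      exact absurd (hsA ▸ U.one_mem) hsU
    · exact Or.inl ⟨_, A.isASubgroup_closure hS, by rw [hcard, pow_one], fun h => hsU (h hsA)⟩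
    · right
      rw [← Subgroup.eq_of_le_of_card_ge hle (by rw [hcard, hHcard])]
      exact A.isASubgroup_closure hS
  -- squares
  have hsq : ∀ S : Set G, A.IsASet S → ∃ W : Set G, A.IsASet W ∧
      (∀ y ∈ S, e * y ∉ S → y ^ 2 ∈ W) ∧ ∀ w ∈ W, ∃ y ∈ S, e * y ∉ S ∧ y ^ 2 = w := by
    intro S hS
    have hroot : ∀ y z : G, z ^ 2 = y ^ 2 → z = y ∨ z = e * y := by
      intro y z h
      rcases hinv (z * y⁻¹) (by rw [mul_pow, inv_pow, h, mul_inv_cancel]) with h | h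
      · exact Or.inl (mul_inv_eq_one.1 h)
      · exact Or.inr (mul_inv_eq_iff_eq_mul.1 h)
    refine ⟨_, hS.powSet Nat.prime_two, ?_, ?_⟩
    · intro y hy hey
      have : {z ∈ S | z ^ 2 = y ^ 2} = {y} := by
        ext z
        constructor
        · rintro ⟨hz, hzy⟩
          rcases hroot y z hzy with h | h
          · exact h
          · exact absurd (h ▸ hz) hey
        · rintro rfl
          exact ⟨hy, rfl⟩
      rw [Set.mem_ofPred_eq, this, Set.ncard_singleton]
      norm_num
    · intro w hw
      rw [Set.mem_ofPred_eq] at hw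
      have hne : {y ∈ S | y ^ 2 = w}.ncard ≠ 0 := fun h => hw (h ▸ dvd_zero 2)
      obtain ⟨y, hy, rfl⟩ := Set.nonempty_of_ncard_ne_zero hne
      refine ⟨y, hy, fun hey => hw ?_, rfl⟩
      have : {z ∈ S | z ^ 2 = y ^ 2} = {y, e * y} := by
        ext z
        constructor
        · rintro ⟨hz, hzy⟩
          exact hroot y z hzy
        · rintro (rfl | rfl)
          · exact ⟨hy, rfl⟩
          · exact ⟨hey, by rw [mul_pow, sq e, hee, one_mul]⟩
      rw [this, Set.ncard_pair (by simpa using he1)]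
  by_cases hinvY : ∀ y ∈ Y, e * y ∈ Y
  · left
    intro g hg
    have hg2 : g ^ 2 = 1 := by
      obtain ⟨i, rfl⟩ := hg
      simp only
      rw [← zpow_natCast, ← zpow_mul, mul_comm, zpow_mul, zpow_natCast, sq, hee, one_zpow]
    have hgY : {g} * Y = Y := by
      rcases hinv g hg2 with rfl | rfl
      · simp
      · ext y
        rw [Set.singleton_mul, Set.mem_image]
        constructor
        · rintro ⟨z, hz, rfl⟩
          exact hinvY z hz
        · exact fun hy => ⟨e * y, hinvY y hy, by rw [← mul_assoc, hee, one_mul]⟩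
    exact ⟨hgY, by rw [mul_comm, hgY]⟩
  right
  push Not at hinvY
  obtain ⟨y₀, hy₀, hey₀⟩ := hinvY
  obtain ⟨W, hW, hW1, hW2⟩ := hsq Y (A.isASet_of_mem_basic hY)
  have hw₀ : y₀ ^ 2 ∈ W := hW1 y₀ hy₀ hey₀
  have hw₀U : y₀ ^ 2 ∉ U := fun h => hYout y₀ hy₀ (hsqU _ h)
  set L := Subgroup.closure W
  have hLA : A.IsASubgroup L := A.isASubgroup_closure hW
  by_cases heL : e ∉ L
  · refine hF W hW (fun w hw => ?_) ⟨_, hw₀, hw₀U⟩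
    have hwL : w ^ p ∈ L := pow_mem (Subgroup.subset_closure hw) p
    apply hmemH
    by_cases h2 : (w ^ p) ^ 2 = 1
    · exact (hC1 _ (hgp w) h2).resolve_right fun h => heL (h ▸ hwL)
    · exact absurd ((hC2 _ (hgp w) h2).1 ▸ pow_mem hwL 2) heL
  rw [not_not] at heL
  have hLD : ∀ l ∈ L, (l ^ p) ^ 2 = 1 := by
    intro l hl
    induction hl using Subgroup.closure_induction with
    | mem w hw =>
      obtain ⟨y, -, -, rfl⟩ := hW2 w hw
      rw [pow_right_comm y 2 p]
      by_cases h : (y ^ p) ^ 2 = 1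
      · rw [h, one_pow]
      · rw [(hC2 _ (hgp y) h).1, sq, hee]
    | one => simp
    | mul a b _ _ ha hb => rw [mul_pow, mul_pow, ha, hb, one_mul]
    | inv a _ ha => rw [inv_pow, inv_pow, ha, inv_one]
  have hLH : ∀ l : G, (l ^ p) ^ 2 = 1 → l ^ 2 ∈ H := fun l hl =>
    hmemH _ (by rw [pow_right_comm, hl])
  have hYL : ∀ y ∈ Y, y ∉ L := by
    intro y hy hyL
    have hYsub : Y ⊆ L := hLA.subset hY hy hyL
    refine heH ((Subgroup.closure_le H).2 ?_ heL)
    intro w hw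
    obtain ⟨z, hz, -, rfl⟩ := hW2 w hw
    exact hLH z (hLD z (hYsub hz))
  by_cases hD : ∀ g : G, (g ^ p) ^ 2 = 1 → g ∈ L
  · have hYsq : ∀ y ∈ Y, (y ^ p) ^ 2 = e := fun y hy =>
      (hC2 _ (hgp y) fun h => hYL y hy (hD y h)).1
    have hFA := (A.isASet_of_mem_basic hY).powSet hp
    have hFC : ∀ g ∈ {g | ¬ p ∣ {y ∈ Y | y ^ p = g}.ncard}, ∃ y ∈ Y, y ^ p = g := by
      intro g hg
      rw [Set.mem_ofPred_eq] at hg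
      have hne : {y ∈ Y | y ^ p = g}.ncard ≠ 0 := fun h => hg (h ▸ dvd_zero p)
      exact Set.nonempty_of_ncard_ne_zero hne
    have hFdvd : ∀ g, p ∣ {y ∈ Y | y ^ p = g}.ncard := by
      intro g
      by_contra hg
      obtain ⟨y, hy, rfl⟩ := hFC g hg
      refine he1 ((hYsq y hy).symm.trans (hCgen _ hFA ?_ _ hg))
      intro g hg
      obtain ⟨y, hy, rfl⟩ := hFC g hg
      exact hgp y
    have hUH : Nat.card (U ⊓ H : Subgroup G) ≤ p := by
      have h1 : Nat.card (U ⊓ H : Subgroup G) ∣ p ^ 2 :=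
        hHcard ▸ Subgroup.card_dvd_of_le inf_le_right
      have h2 : Nat.card (U ⊓ H : Subgroup G) ∣ 4 * p :=
        hU ▸ Subgroup.card_dvd_of_le inf_le_left
      obtain ⟨i, hi, hcard⟩ := (Nat.dvd_prime_pow hp).1 h1
      rw [hcard] at h2 ⊢
      interval_cases i
      · rw [pow_zero]
        exact hp.one_le
      · simp
      · exfalso
        rw [sq] at h2
        have h4 : p ∣ 2 ^ 2 := Nat.dvd_of_mul_dvd_mul_right hp.pos h2
        have := (Nat.prime_dvd_prime_iff_eq hp Nat.prime_two).1 (hp.dvd_of_dvd_pow h4)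
        omega
    have hfull : ∀ y ∈ Y, ∀ u : G, (u : G ⧸ U) = y → u ^ p = y ^ p → u ∈ Y := by
      intro y hy u hu hup
      let N : Set G := (fun v => y * v) '' ((U ⊓ H : Subgroup G) : Set G)
      have hN : ∀ v : G, (v : G ⧸ U) = y → v ^ p = y ^ p → v ∈ N := by
        intro v hv hvp
        refine ⟨y⁻¹ * v, ⟨QuotientGroup.eq.1 hv.symm, hmemH _ ?_⟩, by simp⟩
        rw [mul_pow, inv_pow, hvp, inv_mul_cancel]
      have hNcard : N.ncard ≤ p := by
        refine (Set.ncard_image_le (Set.toFinite _)).trans ?_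
        exact hUH
      have hsub : {z ∈ Y | z ^ p = y ^ p} ⊆ N := fun z hz =>
        hN z (hcos Y hY z hz.1 y hy) hz.2
      have hpos : 0 < {z ∈ Y | z ^ p = y ^ p}.ncard := (Set.ncard_pos).2 ⟨y, hy, rfl⟩
      have heq := Set.eq_of_subset_of_ncard_le hsub
        (hNcard.trans (Nat.le_of_dvd hpos (hFdvd _)))
      have huN := hN u hu hup
      rw [← heq] at huN
      exact huN.1
    have hep : e ^ p = e := by
      rw [hm, pow_succ, pow_mul, sq, hee, one_pow, one_mul]
    have hYp : ∀ y ∈ Y, (y ^ 2) ^ p = e := fun y hy => by rw [pow_right_comm, hYsq y hy]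
    have hYp' : ∀ w ∈ W, w ^ p = e := by
      intro w hw
      obtain ⟨y, hy, -, rfl⟩ := hW2 w hw
      exact hYp y hy
    obtain ⟨V, hV, hV1, hV2⟩ := hsq W hW
    refine hF V hV ?_ ⟨(y₀ ^ 2) ^ 2, hV1 _ hw₀ ?_, fun h => hw₀U (hsqU _ h)⟩
    · intro v hv
      obtain ⟨w, hw, -, rfl⟩ := hV2 v hv
      exact hmemH _ (by rw [pow_right_comm, hYp' w hw, sq, hee])
    · intro h
      have := hYp' _ h
      rw [mul_pow, hYp' _ hw₀, hep, hee] at this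
      exact he1 this.symm
  · exfalso
    have hLU : ∀ z ∈ L, z ∈ U → z = 1 ∨ z = e := by
      intro z hzL hzU
      by_contra hz
      have hz2 : z ^ 2 ≠ 1 := fun h => hz (hinv z h)
      apply hD
      have hHL : H ≤ L := by
        have h1 : Nat.card (L ⊓ H : Subgroup G) ∣ p ^ 2 :=
          hHcard ▸ Subgroup.card_dvd_of_le inf_le_right
        have hzmem : z ^ 2 ∈ L ⊓ H := ⟨pow_mem hzL 2, hLH z (hLD z hzL)⟩
        have hwL : y₀ ^ 2 ∈ L := Subgroup.subset_closure hw₀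
        have hwmem : (y₀ ^ 2) ^ 2 ∈ L ⊓ H := ⟨pow_mem hwL 2, hLH _ (hLD _ hwL)⟩
        obtain ⟨i, hi, hcard⟩ := (Nat.dvd_prime_pow hp).1 h1
        interval_cases i
        · rw [pow_zero, Subgroup.card_eq_one] at hcard
          rw [hcard, Subgroup.mem_bot] at hzmem
          exact absurd hzmem hz2
        · exfalso
          have h2 := Subgroup.card_dvd_of_le (inf_le_left : (L ⊓ H) ⊓ U ≤ L ⊓ H)
          rw [hcard, pow_one, Nat.dvd_prime hp, Subgroup.card_eq_one] at h2
          rcases h2 with h2 | h2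
          · have : z ^ 2 ∈ (L ⊓ H) ⊓ U := ⟨hzmem, pow_mem hzU 2⟩
            rw [h2] at this
            exact hz2 this
          · have h3 := Subgroup.eq_of_le_of_card_ge
              (inf_le_left : (L ⊓ H) ⊓ U ≤ L ⊓ H) (by rw [hcard, h2, pow_one])
            rw [← h3] at hwmem
            exact hw₀U (hsqU _ hwmem.2)
        · rw [← Subgroup.eq_of_le_of_card_ge (inf_le_right : L ⊓ H ≤ H)
            (by rw [hcard, hHcard])]
          exact inf_le_left
      intro g hg
      rw [hid g]
      refine L.mul_mem ?_ (L.inv_mem (pow_mem (hHL (hLH g hg)) m))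
      rcases hinv _ hg with h | h
      · exact h ▸ L.one_mem
      · exact h ▸ heL
    have hthin : A.IsASet ({e} : Set G) := by
      have h := (hLA.inter hUA).diff (A.isASet_of_mem_basic A.one_mem)
      convert h using 1
      ext z
      constructor
      · rintro rfl
        exact ⟨⟨heL, hCU heC⟩, he1⟩
      · rintro ⟨⟨hzL, hzU⟩, hz1⟩
        exact (hLU z hzL hzU).resolve_left hz1
    have hYe : ∀ y ∈ Y, e * y ∉ Y := by
      intro y hy hey
      have hsub : Y ⊆ {e} * Y := (hthin.mul (A.isASet_of_mem_basic hY)).subset hY hey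
        (Set.mul_mem_mul rfl hy)
      obtain ⟨_, rfl, z, hz, hzy⟩ := hsub hy₀
      apply hey₀
      rw [← hzy]
      simpa [← mul_assoc, hee] using hz
    have hYW : ∀ y ∈ Y, y ^ 2 ∈ L := fun y hy =>
      Subgroup.subset_closure (hW1 y hy (hYe y hy))
    let T : Set G := (L : Set G) ∩ {g | (g : G ⧸ U) = (y₀⁻¹ : G)}
    have hTA : A.IsASet T := hLA.inter (hcosA _)
    have hTY : T * Y ⊆ C := by
      rintro _ ⟨t, ⟨htL, ht⟩, y, hy, rfl⟩
      rw [Set.mem_ofPred_eq] at ht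
      have hU' : t * y ∈ U := by
        rw [← QuotientGroup.eq_one_iff, QuotientGroup.mk_mul, ht, hcos Y hY y hy y₀ hy₀,
          ← QuotientGroup.mk_mul, inv_mul_cancel, QuotientGroup.mk_one]
      have hL' : (t * y) ^ 2 ∈ L := by
        rw [mul_pow]
        exact L.mul_mem (pow_mem htL 2) (hYW y hy)
      apply hsqC
      rcases hLU _ hL' (pow_mem hU' 2) with h | h
      · exact h ▸ C.one_mem
      · exact h ▸ heC
    have htT : ((y₀ ^ 2) ^ (m + 1))⁻¹ ∈ T := by
      refine ⟨L.inv_mem (pow_mem (hYW y₀ hy₀) _), ?_⟩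
      rw [Set.mem_ofPred_eq, QuotientGroup.eq, ← pow_mul,
        show 2 * (m + 1) = p + 1 by omega, inv_inv, pow_succ, mul_inv_cancel_right]
      exact hCU (hgp y₀)
    have h1 := hCgen _ (hTA.mul (A.isASet_of_mem_basic hY)) hTY _ (Set.mul_mem_mul htT hy₀)
    apply hYL y₀ hy₀
    rw [← L.mul_mem_cancel_left htT.1]
    rcases hinv _ h1 with h | h
    · exact h ▸ L.one_mem
    · exact h ▸ heL

end Paper
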